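/- Let m ≥ 2 be an integer. For every complex number z with |z| < 1, Σ_{k=1}^∞ (J_m(k)/k)·(−Log(1−z^k)) = Σ_{j=1}^{m−1} T(m−1,j) · z^j/(1−z)^{j+1}, where T(n,j) = Σ_{i=0}^{j} (−1)^i C(j,i) (j−i)^n (so that T(n,j) = j!·S(n,j) with S(n,j) the Stirling number of the second kind); in particular (1/(1−z)) ∏_{k=2}^∞ (1/(1−z^k))^{J_m(k)/k} = exp(Σ_{j=1}^{m−1} T(m−1,j) z^j/(1−z)^{j+1}). -/

import Mathlib

/-- The Jordan totient `J_m(k) = k^m ∏_{p prime, p ∣ k} (1 − p^{−m})`. -/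
def jordanTotient (m k : ℕ) : ℚ :=
  (k : ℚ) ^ m * ∏ p ∈ k.primeFactors, (1 - ((p : ℚ) ^ m)⁻¹)

/-- `T(n,j) = Σ_{i=0}^{j} (−1)^i C(j,i) (j−i)^n`, i.e. `j!` times the Stirling
number of the second kind `S(n,j)`. -/
noncomputable def stirlingT (n j : ℕ) : ℂ :=
  ∑ i ∈ Finset.range (j + 1), (-1 : ℂ) ^ i * (j.choose i : ℂ) * ((j - i : ℕ) : ℂ) ^ n

open Finset in
theorem sum_divisors_jordanTotient {m n : ℕ} (hm : m ≠ 0) :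
    ∑ d ∈ n.divisors, jordanTotient m d = (n : ℚ) ^ m := by
  set J : ArithmeticFunction ℚ := ((ArithmeticFunction.pow m : ArithmeticFunction ℕ) :
    ArithmeticFunction ℚ).pmul (.prodPrimeFactors fun p ↦ 1 - ((p : ℚ) ^ m)⁻¹) with hJ
  have hJmul : J.IsMultiplicative :=
    (ArithmeticFunction.isMultiplicative_pow.natCast).pmul
      (ArithmeticFunction.IsMultiplicative.prodPrimeFactors _)
  have hJ_apply {d : ℕ} (hd : d ≠ 0) : J d = jordanTotient m d := by
    simp [hJ, jordanTotient, hd, hm, ArithmeticFunction.prodPrimeFactors_apply]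
  have key : J * (ArithmeticFunction.zeta : ArithmeticFunction ℚ) =
      ((ArithmeticFunction.pow m : ArithmeticFunction ℕ) : ArithmeticFunction ℚ) := by
    rw [ArithmeticFunction.IsMultiplicative.eq_iff_eq_on_prime_powers _
      (hJmul.mul ArithmeticFunction.isMultiplicative_zeta.natCast) _
      ArithmeticFunction.isMultiplicative_pow.natCast]
    intro p i hp
    have hp0 : (p : ℚ) ≠ 0 := by exact_mod_cast hp.ne_zero
    rw [ArithmeticFunction.coe_mul_zeta_apply, Nat.sum_divisors_prime_pow hp,
      sum_congr rfl fun j _ ↦ hJ_apply (pow_ne_zero j hp.ne_zero)]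
    simp only [ArithmeticFunction.natCoe_apply, ArithmeticFunction.pow_apply, hm, false_and,
      if_false, Nat.cast_pow]
    induction i with
    | zero => simp [jordanTotient]
    | succ i ih =>
      rw [sum_range_succ, ih, jordanTotient, Nat.primeFactors_prime_pow i.succ_ne_zero hp,
        prod_singleton]
      push_cast
      field_simp
      ring
  have := congrArg (fun f : ArithmeticFunction ℚ ↦ f n) key
  simp only [ArithmeticFunction.coe_mul_zeta_apply, ArithmeticFunction.natCoe_apply,
    ArithmeticFunction.pow_apply, hm, false_and, if_false, Nat.cast_pow] at this
  rw [← this]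
  exact sum_congr rfl fun d hd ↦ (hJ_apply (Nat.pos_of_mem_divisors hd).ne').symm

theorem abs_jordanTotient_le (m k : ℕ) : |jordanTotient m k| ≤ (k : ℚ) ^ m := by
  have h (p : ℕ) (hp : p ∈ k.primeFactors) : |1 - ((p : ℚ) ^ m)⁻¹| ≤ 1 := by
    have hp1 : (1 : ℚ) ≤ (p : ℚ) ^ m :=
      one_le_pow₀ (by exact_mod_cast (Nat.prime_of_mem_primeFactors hp).one_le)
    have h1 := inv_le_one_of_one_le₀ hp1
    have h0 : 0 ≤ ((p : ℚ) ^ m)⁻¹ := by positivity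
    rw [abs_le]
    constructor <;> linarith
  rw [jordanTotient, abs_mul, abs_of_nonneg (by positivity : (0 : ℚ) ≤ (k : ℚ) ^ m),
    Finset.abs_prod]
  exact mul_le_of_le_one_right (by positivity)
    (Finset.prod_le_one (fun _ _ ↦ abs_nonneg _) h)

theorem norm_jordanTotient_le (m k : ℕ) : ‖(jordanTotient m k : ℂ)‖ ≤ (k : ℝ) ^ m := by
  rw [Complex.norm_ratCast]
  exact_mod_cast abs_jordanTotient_le m k

theorem stirlingT_eq_fwdDiff (n j : ℕ) :
    stirlingT n j = (fwdDiff (1 : ℂ))^[j] (fun x ↦ x ^ n) 0 := by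
  rw [fwdDiff_iter_eq_sum_shift, ← Finset.sum_range_reflect, stirlingT]
  refine Finset.sum_congr rfl fun i hi ↦ ?_
  have hi : i ≤ j := Nat.lt_succ_iff.mp (Finset.mem_range.mp hi)
  have h : j + 1 - 1 - i = j - i := by omega
  rw [h, Nat.sub_sub_self hi, Nat.choose_symm hi]
  simp

theorem stirlingT_eq_zero_of_lt {n j : ℕ} (h : n < j) : stirlingT n j = 0 := by
  rw [stirlingT_eq_fwdDiff, fwdDiff_iter_pow_eq_zero_of_lt h, Pi.zero_apply]

theorem stirlingT_zero_right {n : ℕ} (hn : n ≠ 0) : stirlingT n 0 = 0 := by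
  simp [stirlingT, hn]

theorem pow_eq_sum_choose_mul_stirlingT {n : ℕ} (hn : n ≠ 0) (N : ℕ) :
    (N : ℂ) ^ n = ∑ j ∈ Finset.Icc 1 n, stirlingT n j * (N.choose j : ℂ) := by
  have h := shift_eq_sum_fwdDiff_iter (1 : ℂ) (fun x ↦ x ^ n) N 0
  simp only [zero_add, nsmul_eq_mul, mul_one, ← stirlingT_eq_fwdDiff] at h
  rw [h]
  have h₁ : ∑ j ∈ Finset.range (N + 1), (N.choose j : ℂ) * stirlingT n j =
      ∑ j ∈ Finset.range (N + n + 1), (N.choose j : ℂ) * stirlingT n j :=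
    Finset.sum_subset (Finset.range_mono (by omega)) fun j _ hj ↦ by
      rw [Nat.choose_eq_zero_of_lt (by simpa using hj), Nat.cast_zero, zero_mul]
  have h₂ : ∑ j ∈ Finset.Icc 1 n, (N.choose j : ℂ) * stirlingT n j =
      ∑ j ∈ Finset.range (N + n + 1), (N.choose j : ℂ) * stirlingT n j := by
    refine Finset.sum_subset (fun j hj ↦ ?_) fun j _ hj ↦ ?_
    · simp only [Finset.mem_Icc, Finset.mem_range] at hj ⊢
      omega
    · rcases Nat.eq_zero_or_pos j with rfl | hj0
      · rw [stirlingT_zero_right hn, mul_zero]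
      · rw [stirlingT_eq_zero_of_lt, mul_zero]
        simp only [Finset.mem_Icc, not_and, not_le] at hj
        exact hj hj0
  rw [h₁, ← h₂]
  exact Finset.sum_congr rfl fun _ _ ↦ mul_comm _ _

theorem hasSum_choose_mul_pow (j : ℕ) {z : ℂ} (hz : ‖z‖ < 1) :
    HasSum (fun N : ℕ ↦ (N.choose j : ℂ) * z ^ N) (z ^ j / (1 - z) ^ (j + 1)) := by
  rw [← hasSum_nat_add_iff' j, Finset.sum_eq_zero, sub_zero]
  · convert! (hasSum_choose_mul_geometric_of_norm_lt_one j hz).mul_left (z ^ j) using 1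
    · ext N
      ring
    · ring
  · intro i hi
    rw [Nat.choose_eq_zero_of_lt (Finset.mem_range.mp hi), Nat.cast_zero, zero_mul]

theorem hasSum_pow_mul_geometric {n : ℕ} (hn : n ≠ 0) {z : ℂ} (hz : ‖z‖ < 1) :
    HasSum (fun N : ℕ ↦ (N : ℂ) ^ n * z ^ N)
      (∑ j ∈ Finset.Icc 1 n, stirlingT n j * z ^ j / (1 - z) ^ (j + 1)) := by
  simp_rw [pow_eq_sum_choose_mul_stirlingT hn, Finset.sum_mul, mul_assoc, mul_div_assoc]
  exact hasSum_sum fun j _ ↦ (hasSum_choose_mul_pow j hz).mul_left _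

theorem summable_jordanTotient_mul_pow (m : ℕ) {z : ℂ} (hz : ‖z‖ < 1) :
    Summable fun c : ℕ+ × ℕ+ ↦
      (jordanTotient m c.1 : ℂ) / (c.1 : ℂ) * ((z ^ (c.1 : ℕ)) ^ (c.2 : ℕ) / (c.2 : ℂ)) := by
  have hs := (Equiv.prodComm ℕ+ ℕ+).summable_iff.mpr
    (summable_prod_mul_pow m (r := ‖z‖) (by simpa using hz))
  refine Summable.of_norm_bounded hs fun c ↦ ?_
  have h1 : (1 : ℝ) ≤ (c.1 : ℕ) := by exact_mod_cast c.1.2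
  have h2 : (1 : ℝ) ≤ (c.2 : ℕ) := by exact_mod_cast c.2.2
  simp only [Function.comp_apply, Equiv.prodComm_apply, Prod.fst_swap, Prod.snd_swap, norm_mul,
    norm_div, norm_pow, Complex.norm_natCast, ← pow_mul, mul_comm (c.2 : ℕ)]
  exact mul_le_mul ((div_le_self (norm_nonneg _) h1).trans (norm_jordanTotient_le m _))
    (div_le_self (by positivity) h2) (by positivity) (by positivity)

theorem hasSum_pow_div_pnat {w : ℂ} (hw : ‖w‖ < 1) :
    HasSum (fun n : ℕ+ ↦ w ^ (n : ℕ) / ((n : ℕ) : ℂ)) (-Complex.log (1 - w)) := by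
  rw [← Equiv.pnatEquivNat.symm.hasSum_iff]
  simpa [Function.comp_def] using Complex.hasSum_taylorSeries_neg_log' hw

open Finset in
theorem sum_divisorsAntidiagonal_jordanTotient_mul_pow {m n : ℕ} (hm : m ≠ 0) (hn : n ≠ 0)
    (z : ℂ) :
    ∑ x ∈ n.divisorsAntidiagonal,
        (jordanTotient m x.1 : ℂ) / (x.1 : ℂ) * ((z ^ x.1) ^ x.2 / (x.2 : ℂ)) =
      (n : ℂ) ^ (m - 1) * z ^ n := by
  have hn' : (n : ℂ) ≠ 0 := by exact_mod_cast hn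
  have hterm (x : ℕ × ℕ) (hx : x ∈ n.divisorsAntidiagonal) :
      (jordanTotient m x.1 : ℂ) / (x.1 : ℂ) * ((z ^ x.1) ^ x.2 / (x.2 : ℂ)) =
        (jordanTotient m x.1 : ℂ) * (z ^ n / (n : ℂ)) := by
    have hx := (Nat.mem_divisorsAntidiagonal.mp hx).1
    rw [← pow_mul, hx, div_mul_div_comm, ← Nat.cast_mul, hx, mul_div_assoc]
  rw [sum_congr rfl hterm, ← sum_mul,
    Nat.sum_divisorsAntidiagonal (f := fun d _ ↦ (jordanTotient m d : ℂ)), ← Rat.cast_sum, sum_divisors_jordanTotient hm]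
  obtain ⟨k, rfl⟩ := Nat.exists_eq_succ_of_ne_zero hm
  push_cast
  rw [Nat.succ_eq_add_one, pow_succ]
  field_simp

theorem hasSum_pow_mul_geometric_pnat {m : ℕ} (hm : m ≠ 0) {z a : ℂ}
    (h : HasSum (fun c : ℕ+ × ℕ+ ↦
      (jordanTotient m c.1 : ℂ) / (c.1 : ℂ) * ((z ^ (c.1 : ℕ)) ^ (c.2 : ℕ) / (c.2 : ℂ))) a) :
    HasSum (fun n : ℕ+ ↦ ((n : ℕ) : ℂ) ^ (m - 1) * z ^ (n : ℕ)) a := by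
  refine (sigmaAntidiagonalEquivProd.hasSum_iff.mpr h).sigma fun n ↦ ?_
  rw [← sum_divisorsAntidiagonal_jordanTotient_mul_pow hm n.ne_zero z, ← Finset.sum_coe_sort]
  exact hasSum_fintype _

theorem hasSum_jordanTotient_log {m : ℕ} (hm : 2 ≤ m) {z : ℂ} (hz : ‖z‖ < 1) :
    HasSum (fun k : ℕ ↦
        ((jordanTotient m (k + 1) : ℂ) / ((k + 1 : ℕ) : ℂ)) * (-(Complex.log (1 - z ^ (k + 1)))))
      (∑ j ∈ Finset.Icc 1 (m - 1), stirlingT (m - 1) j * z ^ j / (1 - z) ^ (j + 1)) := by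
  obtain ⟨a, hF⟩ := summable_jordanTotient_mul_pow m hz
  have hlog : HasSum (fun k : ℕ+ ↦ (jordanTotient m k : ℂ) / ((k : ℕ) : ℂ) *
      (-(Complex.log (1 - z ^ (k : ℕ))))) a := by
    refine hF.prod_fiberwise fun k ↦ ?_
    have hzk : ‖z ^ (k : ℕ)‖ < 1 := by
      rw [norm_pow]
      exact pow_lt_one₀ (norm_nonneg _) hz k.ne_zero
    exact (hasSum_pow_div_pnat hzk).mul_left ((jordanTotient m k : ℂ) / ((k : ℕ) : ℂ))
  have hpow := hasSum_pow_mul_geometric_pnat (by omega) hF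
  have hm1 : m - 1 ≠ 0 := by omega
  have hgeom := hasSum_pow_mul_geometric hm1 hz
  rw [← hasSum_nat_add_iff' 1] at hgeom
  simp only [Finset.sum_range_one, Nat.cast_zero, zero_pow hm1, zero_mul, sub_zero] at hgeom
  rw [← Equiv.pnatEquivNat.symm.hasSum_iff] at hpow hlog
  simp only [Function.comp_def, Equiv.pnatEquivNat_symm_apply, Nat.succPNat_coe,
    Nat.succ_eq_add_one] at hpow hlog
  rw [hpow.unique hgeom] at hlog
  exact hlog

/-- For `m ≥ 2` and `|z| < 1`:
`Σ_{k≥1} (J_m(k)/k)(−Log(1−z^k)) = Σ_{j=1}^{m−1} T(m−1,j) z^j/(1−z)^{j+1}`,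
and in particular
`(1/(1−z)) ∏_{k=2}^∞ (1/(1−z^k))^{J_m(k)/k} = exp(Σ_{j=1}^{m−1} T(m−1,j) z^j/(1−z)^{j+1})`. -/
theorem jordanTotient_product_stirling (m : ℕ) (hm : 2 ≤ m) (z : ℂ) (hz : ‖z‖ < 1) :
    (∑' k : ℕ,
        ((jordanTotient m (k + 1) : ℂ) / ((k + 1 : ℕ) : ℂ)) * (-(Complex.log (1 - z ^ (k + 1))))) =
      ∑ j ∈ Finset.Icc 1 (m - 1), stirlingT (m - 1) j * z ^ j / (1 - z) ^ (j + 1) ∧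
    (1 / (1 - z)) * ∏' k : ℕ,
        (1 / (1 - z ^ (k + 2))) ^ ((jordanTotient m (k + 2) : ℂ) / ((k + 2 : ℕ) : ℂ)) =
      Complex.exp (∑ j ∈ Finset.Icc 1 (m - 1), stirlingT (m - 1) j * z ^ j / (1 - z) ^ (j + 1)) := by
  have hsum := hasSum_jordanTotient_log hm hz
  refine ⟨hsum.tsum_eq, ?_⟩
  have hz' (k : ℕ) : ‖-z ^ (k + 1)‖ < 1 := by
    rw [norm_neg, norm_pow]
    exact pow_lt_one₀ (norm_nonneg _) hz k.succ_ne_zero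
  have hslit (k : ℕ) : 1 - z ^ (k + 1) ∈ Complex.slitPlane := by
    simpa [sub_eq_add_neg] using Complex.mem_slitPlane_of_norm_lt_one (hz' k)
  have hfactor (k : ℕ) : Complex.exp
      ((jordanTotient m (k + 1) : ℂ) / ((k + 1 : ℕ) : ℂ) * (-(Complex.log (1 - z ^ (k + 1))))) =
      (1 / (1 - z ^ (k + 1))) ^ ((jordanTotient m (k + 1) : ℂ) / ((k + 1 : ℕ) : ℂ)) := by
    have hne := Complex.slitPlane_ne_zero (hslit k)
    rw [Complex.cpow_def_of_ne_zero (one_div_ne_zero hne), one_div,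
      Complex.log_inv _ (Complex.slitPlane_arg_ne_pi (hslit k)), mul_comm]
  have htail := ((hasSum_nat_add_iff' 1).mpr hsum).cexp
  have hprod := htail.tprod_eq
  simp only [Function.comp_apply, hfactor, Finset.sum_range_one, Complex.exp_sub] at hprod
  have hfirst : (1 / (1 - z ^ (0 + 1))) ^
      ((jordanTotient m (0 + 1) : ℂ) / ((0 + 1 : ℕ) : ℂ)) = 1 / (1 - z) := by
    simp [jordanTotient]
  rw [hfirst] at hprod
  have hne : 1 / (1 - z) ≠ 0 :=
    one_div_ne_zero (by simpa using Complex.slitPlane_ne_zero (hslit 0))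
  rw [hprod, mul_div_cancel₀ _ hne]
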